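/- Let c > 0, c₀ > 0, T > 0, let F : ℝ → ℝ and H : ℝ → ℝ be continuous, and let D_T = {(x,t) : 0 ≤ x/c ≤ t ≤ T − x/c}. Suppose u : ℝ × ℝ → ℝ is twice continuously differentiable on an open set containing D_T, satisfies u_tt − c² u_xx = F(x) H(t − x/c) on D_T, satisfies u(x,t) = 0 whenever t ≤ x/c, and satisfies the boundary condition u_t(0,t) − c₀ u_x(0,t) = 0 for all t ∈ [0,T]. Then for every t ∈ [0,T]: u_t(0,t) = (c₀/(c(c+c₀))) ∫₀^{ct/2} F(ξ) H(t − 2ξ/c) dξ. -/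

import Mathlib

/-- The time slice of a function on the plane has derivative `Du (0, 1)`. -/
theorem hasDerivAt_slice_snd {u : ℝ × ℝ → ℝ} {x t : ℝ} (h : DifferentiableAt ℝ u (x, t)) :
    HasDerivAt (fun t' => u (x, t')) (fderiv ℝ u (x, t) (0, 1)) t :=
  h.hasFDerivAt.comp_hasDerivAt t ((hasDerivAt_const t x).prodMk (hasDerivAt_id t))

/-- The space slice of a function on the plane has derivative `Du (1, 0)`. -/
theorem hasDerivAt_slice_fst {u : ℝ × ℝ → ℝ} {x t : ℝ} (h : DifferentiableAt ℝ u (x, t)) :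
    HasDerivAt (fun x' => u (x', t)) (fderiv ℝ u (x, t) (1, 0)) x :=
  h.hasFDerivAt.comp_hasDerivAt x ((hasDerivAt_id x).prodMk (hasDerivAt_const x t))

theorem ContDiffAt.eventually_differentiableAt {u : ℝ × ℝ → ℝ} {p : ℝ × ℝ}
    (h : ContDiffAt ℝ 2 u p) : ∀ᶠ q in nhds p, DifferentiableAt ℝ u q :=
  (h.eventually (by simp)).mono fun _ hq => hq.differentiableAt (by simp)

theorem ContDiffAt.differentiableAt_fderiv {u : ℝ × ℝ → ℝ} {p : ℝ × ℝ}
    (h : ContDiffAt ℝ 2 u p) : DifferentiableAt ℝ (fderiv ℝ u) p :=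
  (h.fderiv_right (m := 1) (by norm_num)).differentiableAt (by simp)

theorem deriv_deriv_slice_snd {u : ℝ × ℝ → ℝ} {x t : ℝ} (h : ContDiffAt ℝ 2 u (x, t)) :
    deriv (deriv fun t' => u (x, t')) t = fderiv ℝ (fderiv ℝ u) (x, t) (0, 1) (0, 1) := by
  have hcont : ContinuousAt (fun t' : ℝ => (x, t')) t := by fun_prop
  have heq : deriv (fun t' => u (x, t')) =ᶠ[nhds t] fun t' => fderiv ℝ u (x, t') (0, 1) :=
    (hcont.eventually h.eventually_differentiableAt).mono
      fun _ hq => (hasDerivAt_slice_snd hq).deriv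
  rw [heq.deriv_eq]
  have hd := h.differentiableAt_fderiv.hasFDerivAt.comp_hasDerivAt t
    ((hasDerivAt_const t x).prodMk (hasDerivAt_id t))
  simpa using (hd.clm_apply (hasDerivAt_const t ((0 : ℝ), (1 : ℝ)))).deriv

theorem deriv_deriv_slice_fst {u : ℝ × ℝ → ℝ} {x t : ℝ} (h : ContDiffAt ℝ 2 u (x, t)) :
    deriv (deriv fun x' => u (x', t)) x = fderiv ℝ (fderiv ℝ u) (x, t) (1, 0) (1, 0) := by
  have hcont : ContinuousAt (fun x' : ℝ => (x', t)) x := by fun_prop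
  have heq : deriv (fun x' => u (x', t)) =ᶠ[nhds x] fun x' => fderiv ℝ u (x', t) (1, 0) :=
    (hcont.eventually h.eventually_differentiableAt).mono
      fun _ hq => (hasDerivAt_slice_fst hq).deriv
  rw [heq.deriv_eq]
  have hd := h.differentiableAt_fderiv.hasFDerivAt.comp_hasDerivAt x
    ((hasDerivAt_id x).prodMk (hasDerivAt_const x t))
  simpa using (hd.clm_apply (hasDerivAt_const x ((1 : ℝ), (0 : ℝ)))).deriv

theorem ContinuousLinearMap.apply_prod_eq {E : Type*} [NormedAddCommGroup E] [NormedSpace ℝ E]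
    (L : ℝ × ℝ →L[ℝ] E) (a b : ℝ) : L (a, b) = a • L (1, 0) + b • L (0, 1) := by
  rw [← map_smul, ← map_smul, ← map_add]
  simp

/-- Along the incoming characteristic `ξ ↦ (ξ, t - ξ / c)`, the derivative of `u_t + c u_x` is
`-(u_tt - c² u_xx) / c`. -/
theorem hasDerivAt_fderiv_characteristic {u : ℝ × ℝ → ℝ} {c t ξ : ℝ} (hc : c ≠ 0)
    (h : ContDiffAt ℝ 2 u (ξ, t - ξ / c)) :
    HasDerivAt (fun ξ => fderiv ℝ u (ξ, t - ξ / c) (c, 1))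
      (-(1 / c) * (deriv (deriv fun t' => u (ξ, t')) (t - ξ / c) -
        c ^ 2 * deriv (deriv fun x' => u (x', t - ξ / c)) ξ)) ξ := by
  have hpath : HasDerivAt (fun ξ : ℝ => (ξ, t - ξ / c)) (1, -(1 / c)) ξ :=
    (hasDerivAt_id ξ).prodMk (((hasDerivAt_id ξ).div_const c).const_sub t)
  have hD : HasDerivAt (fun ξ => fderiv ℝ u (ξ, t - ξ / c))
      (fderiv ℝ (fderiv ℝ u) (ξ, t - ξ / c) (1, -(1 / c))) ξ :=
    h.differentiableAt_fderiv.hasFDerivAt.comp_hasDerivAt ξ hpath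
  have hd := hD.clm_apply (hasDerivAt_const ξ (c, (1 : ℝ)))
  have hsymm := (h.isSymmSndFDerivAt (by simp)).eq (1, 0) (0, 1)
  rw [deriv_deriv_slice_snd h, deriv_deriv_slice_fst h]
  refine hd.congr_deriv ?_
  generalize fderiv ℝ (fderiv ℝ u) (ξ, t - ξ / c) = B at hsymm ⊢
  rw [map_zero, add_zero, ContinuousLinearMap.apply_prod_eq _ c 1,
    ContinuousLinearMap.apply_prod_eq B 1]
  simp only [add_apply, smul_apply, smul_eq_mul, hsymm]
  field_simp
  ring


/-- For a causal `C²` solution of the wave equation `u_tt - c² u_xx = F(x) H(t - x/c)` on the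
triangular domain `D_T` satisfying the absorbing boundary condition
`u_t(0,t) - c₀ u_x(0,t) = 0`, the boundary time derivative has the explicit
integral representation `u_t(0,t) = (c₀/(c(c+c₀))) ∫₀^{ct/2} F(ξ) H(t - 2ξ/c) dξ`. -/
theorem stmt_4 (c c₀ T : ℝ) (hc : 0 < c) (hc₀ : 0 < c₀) (hT : 0 < T)
    (F H : ℝ → ℝ) (hF : Continuous F) (hH : Continuous H)
    (DT : Set (ℝ × ℝ))
    (hDT : DT = {p : ℝ × ℝ | 0 ≤ p.1 / c ∧ p.1 / c ≤ p.2 ∧ p.2 ≤ T - p.1 / c})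
    (u : ℝ × ℝ → ℝ) (Ω : Set (ℝ × ℝ)) (hΩ : IsOpen Ω) (hsub : DT ⊆ Ω)
    (hu : ContDiffOn ℝ 2 u Ω)
    (hwave : ∀ p ∈ DT,
      deriv (deriv (fun t' => u (p.1, t'))) p.2 -
        c ^ 2 * deriv (deriv (fun x' => u (x', p.2))) p.1 =
      F p.1 * H (p.2 - p.1 / c))
    (hzero : ∀ x t : ℝ, t ≤ x / c → u (x, t) = 0)
    (hbc : ∀ t ∈ Set.Icc (0 : ℝ) T,
      deriv (fun t' => u (0, t')) t - c₀ * deriv (fun x' => u (x', t)) 0 = 0) :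
    ∀ t ∈ Set.Icc (0 : ℝ) T,
      deriv (fun t' => u (0, t')) t =
        c₀ / (c * (c + c₀)) * ∫ ξ in (0:ℝ)..(c * t / 2), F ξ * H (t - 2 * ξ / c) := by
  intro t ht
  have hDT_smooth : ∀ p ∈ DT, ContDiffAt ℝ 2 u p := fun p hp =>
    hu.contDiffAt (hΩ.mem_nhds (hsub hp))
  have hct : 0 ≤ c * t / 2 := div_nonneg (mul_nonneg hc.le ht.1) zero_le_two
  have hmem : ∀ ξ ∈ Set.uIcc 0 (c * t / 2), (ξ, t - ξ / c) ∈ DT := by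
    intro ξ hξ
    rw [Set.uIcc_of_le hct] at hξ
    have h0 : 0 ≤ ξ / c := div_nonneg hξ.1 hc.le
    have h1 : ξ / c ≤ t / 2 := by
      rw [div_le_iff₀ hc]
      linarith [hξ.2]
    rw [hDT]
    exact ⟨h0, by dsimp only; linarith, by dsimp only; linarith [ht.2]⟩
  have hderiv : ∀ ξ ∈ Set.uIcc 0 (c * t / 2),
      HasDerivAt (fun ξ => fderiv ℝ u (ξ, t - ξ / c) (c, 1))
        (-(1 / c) * (F ξ * H (t - 2 * ξ / c))) ξ := by
    intro ξ hξ
    refine (hasDerivAt_fderiv_characteristic hc.ne'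
      (hDT_smooth _ (hmem ξ hξ))).congr_deriv ?_
    rw [hwave _ (hmem ξ hξ)]
    ring_nf
  have hint := intervalIntegral.integral_eq_sub_of_hasDerivAt hderiv
    (Continuous.intervalIntegrable (by fun_prop) _ _)
  have hfront : fderiv ℝ u (c * t / 2, t - c * t / 2 / c) (c, 1) = 0 := by
    have hdiff := (hDT_smooth _ (hmem _ Set.right_mem_uIcc)).differentiableAt (by simp)
    have hline := hdiff.hasFDerivAt.comp_hasDerivAt_of_eq (0 : ℝ)
      ((((hasDerivAt_id (0 : ℝ)).const_mul c).const_add (c * t / 2)).prodMk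
        ((hasDerivAt_id (0 : ℝ)).const_add (t - c * t / 2 / c))) (by simp)
    have hvanish : (u ∘ fun s : ℝ => (c * t / 2 + c * id s, t - c * t / 2 / c + id s)) =
        fun _ => 0 := by
      funext s
      refine hzero _ _ (le_of_eq ?_)
      simp only [id]
      field_simp
      ring
    rw [hvanish] at hline
    simpa using hline.unique (hasDerivAt_const (0 : ℝ) (0 : ℝ))
  have hdiff₀ : DifferentiableAt ℝ u (0, t) := by
    have h := hmem 0 Set.left_mem_uIcc
    rw [zero_div, sub_zero] at h
    exact (hDT_smooth _ h).differentiableAt (by simp)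
  have hb := hbc t ht
  rw [(hasDerivAt_slice_fst hdiff₀).deriv, (hasDerivAt_slice_snd hdiff₀).deriv] at hb
  rw [hfront, zero_div, sub_zero, intervalIntegral.integral_const_mul,
    ContinuousLinearMap.apply_prod_eq _ c 1, smul_eq_mul, smul_eq_mul] at hint
  rw [(hasDerivAt_slice_snd hdiff₀).deriv]
  have hsum : c + c₀ ≠ 0 := (add_pos hc hc₀).ne'
  field_simp at hint ⊢
  linear_combination c ^ 2 * hb + c₀ * hint
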